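/- arXiv:1801.07416 — 6 statements merged into one kernel-verified Lean document; each statement's English description precedes it below -/
import Mathlib

section
/- Let n ≥ 1, r ≥ 1 and let m : Fin n → Fin r → ℤ be a weight matrix whose rows m_1, …, m_n are pairwise distinct, and assume the non-resonance condition: the only γ ∈ ℕ^n with Σ_{l} γ_l m_{lj} = 0 for all 1 ≤ j ≤ r is γ = 0. Then for all indices i ≠ j, it is impossible that both m_i < m_j and m_j < m_i hold; i.e., one cannot simultaneously have some α ∈ E_j with α_i ≠ 0 and some β ∈ E_i with β_j ≠ 0. -/
/-- Removing one copy of row `i` from a combination that uses it subtracts `m i`. -/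
lemma sum_sub_single_mul {ι κ : Type*} [Fintype ι] [DecidableEq ι] (m : ι → κ → ℤ)
    {α : ι → ℕ} {i : ι} (hi : α i ≠ 0) (k : κ) :
    ∑ l, ((α - Pi.single i 1 : ι → ℕ) l : ℤ) * m l k = ∑ l, (α l : ℤ) * m l k - m i k := by
  have hle : Pi.single i 1 ≤ α := by
    intro l
    rcases eq_or_ne l i with rfl | hl
    · simpa using Nat.one_le_iff_ne_zero.mpr hi
    · simp [hl]
  have hα : ∀ l, (α l : ℤ) =
      (α - Pi.single i 1 : ι → ℕ) l + (Pi.single i 1 : ι → ℕ) l := fun l ↦ by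
    exact_mod_cast (Nat.sub_add_cancel (hle l)).symm
  simp_rw [hα, add_mul, Finset.sum_add_distrib]
  simp [Pi.single_apply]

/-- If the weight rows are pairwise distinct and the non-resonance
condition holds, then for `i ≠ j` one cannot have both `m_i < m_j` and `m_j < m_i`,
i.e. both some `α ∈ E_j` with `α_i ≠ 0` and some `β ∈ E_i` with `β_j ≠ 0`. -/
theorem stmt_0 (n r : ℕ) (hn : 1 ≤ n) (hr : 1 ≤ r) (m : Fin n → Fin r → ℤ)
    (hdist : ∀ i j : Fin n, i ≠ j → m i ≠ m j)
    (hnonres : ∀ γ : Fin n → ℕ, (∀ j : Fin r, ∑ l, (γ l : ℤ) * m l j = 0) → γ = 0) :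
    ∀ i j : Fin n, i ≠ j →
      ¬((∃ α : Fin n → ℕ, (∀ k : Fin r, ∑ l, (α l : ℤ) * m l k = m j k) ∧ α i ≠ 0) ∧
        (∃ β : Fin n → ℕ, (∀ k : Fin r, ∑ l, (β l : ℤ) * m l k = m i k) ∧ β j ≠ 0)) := by
  rintro i j hij ⟨⟨α, hα, hαi⟩, β, hβ, hβj⟩
  have hα' := sum_sub_single_mul m hαi
  have hβ' := sum_sub_single_mul m hβj
  have hzero : (α - Pi.single i 1) + (β - Pi.single j 1) = 0 := hnonres _ fun k ↦ by
    simp only [Pi.add_apply, Nat.cast_add, add_mul, Finset.sum_add_distrib, 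
      hα', hβ', hα, hβ]
    ring
  have hαzero : α - Pi.single i 1 = 0 := (add_eq_zero.mp hzero).1
  refine hdist i j hij (funext fun k ↦ ?_)
  have hk := hα' k
  simp only [hαzero, hα, Pi.zero_apply, Nat.cast_zero, zero_mul, Finset.sum_const_zero] at hk
  linarith
end

section
/- Let n ≥ 1, r ≥ 1 and let m : Fin n → Fin r → ℤ be a weight matrix. Let i, j, k be indices with i ≠ j. If there exists α ∈ E_j with α_i ≥ 1 and there exists δ ∈ E_k with δ_j ≥ 1, then there exists ε ∈ E_k with ε_i ≥ 1. (In other words, the relation m_i < m_j on weights is transitive.) -/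
/-- The relation `m_i < m_j` (there exists `α ∈ E_j` with `α_i ≠ 0`)
is transitive: if `m_i < m_j` and `m_j < m_k` then `m_i < m_k`. -/
theorem stmt_3 (n r : ℕ) (hn : 1 ≤ n) (hr : 1 ≤ r) (m : Fin n → Fin r → ℤ)
    (i j k : Fin n) (hij : i ≠ j)
    (hα : ∃ α : Fin n → ℕ, (∀ p : Fin r, ∑ l, (α l : ℤ) * m l p = m j p) ∧ 1 ≤ α i)
    (hδ : ∃ δ : Fin n → ℕ, (∀ p : Fin r, ∑ l, (δ l : ℤ) * m l p = m k p) ∧ 1 ≤ δ j) :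
    ∃ ε : Fin n → ℕ, (∀ p : Fin r, ∑ l, (ε l : ℤ) * m l p = m k p) ∧ 1 ≤ ε i := by
  obtain ⟨α, hα, hαi⟩ := hα
  obtain ⟨δ, hδ, hδj⟩ := hδ
  -- Substitute the resonance `α` for one occurrence of `j` in `δ`.
  refine ⟨fun l => (δ l - if l = j then 1 else 0) + α l, fun p => ?_, by dsimp only; omega⟩
  have hcast (l : Fin n) : (((δ l - if l = j then 1 else 0) + α l : ℕ) : ℤ) * m l p =
      (δ l : ℤ) * m l p - (if l = j then m l p else 0) + (α l : ℤ) * m l p := by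
    split_ifs with h
    · subst h
      push_cast [Nat.cast_sub hδj]
      ring
    · simp [add_mul]
  simp only [hcast, Finset.sum_add_distrib, Finset.sum_sub_distrib, hα, hδ,
    Finset.sum_ite_eq', Finset.mem_univ, if_true, sub_add_cancel]
end

section
/- Let n ≥ 1, r ≥ 1 and let m : Fin n → Fin r → ℤ be a weight matrix whose rows m_1, …, m_n are pairwise distinct, and assume the non-resonance condition: the only γ ∈ ℕ^n with Σ_{l} γ_l m_{lj} = 0 for all 1 ≤ j ≤ r is γ = 0. Then the weights can be properly ordered: there exists a permutation π of {1,…,n} such that for all i ≠ j, if m_{π(i)} < m_{π(j)} (i.e., there exists α ∈ E_{π(j)} with α_{π(i)} ≠ 0), then i < j. -/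
/-- The relation `m a ≤ m b`: some resonant exponent of `m b` involves the index `a`. -/
def ResonantLE {ι κ : Type*} [Fintype ι] (m : ι → κ → ℤ) (a b : ι) : Prop :=
  ∃ α : ι → ℕ, (∀ k, ∑ l, (α l : ℤ) * m l k = m b k) ∧ α a ≠ 0

theorem exists_eq_add_single {ι : Type*} [DecidableEq ι] {α : ι → ℕ} {a : ι} (h : α a ≠ 0) :
    ∃ β : ι → ℕ, α = β + Pi.single a 1 := by
  refine ⟨α - Pi.single a 1, (tsub_add_cancel_of_le fun l => ?_).symm⟩
  by_cases hl : l = a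
  · subst hl
    simpa using Nat.one_le_iff_ne_zero.mpr h
  · simp [hl]

section Resonance

variable {ι κ : Type*} [Fintype ι] {m : ι → κ → ℤ}

theorem sum_cast_add_mul (α β : ι → ℕ) (k : κ) :
    ∑ l, ((α + β) l : ℤ) * m l k = ∑ l, (α l : ℤ) * m l k + ∑ l, (β l : ℤ) * m l k := by
  simp [add_mul, Finset.sum_add_distrib]

variable [DecidableEq ι]

theorem sum_cast_single_mul (a : ι) (k : κ) :
    ∑ l, ((Pi.single a 1 : ι → ℕ) l : ℤ) * m l k = m a k := by
  simp [Pi.single_apply]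

theorem ResonantLE.refl (m : ι → κ → ℤ) (a : ι) : ResonantLE m a a :=
  ⟨Pi.single a 1, sum_cast_single_mul a, by simp⟩

theorem ResonantLE.trans {a b c : ι} (hab : ResonantLE m a b) (hbc : ResonantLE m b c) :
    ResonantLE m a c := by
  obtain ⟨α, hα, ha⟩ := hab
  obtain ⟨β, hβ, hb⟩ := hbc
  obtain ⟨β, rfl⟩ := exists_eq_add_single hb
  refine ⟨β + α, fun k => ?_, by simp [ha]⟩
  rw [sum_cast_add_mul, hα, ← hβ k, sum_cast_add_mul, sum_cast_single_mul]

theorem ResonantLE.antisymm (hm : Function.Injective m)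
    (hnonres : ∀ γ : ι → ℕ, (∀ k, ∑ l, (γ l : ℤ) * m l k = 0) → γ = 0)
    {a b : ι} (hab : ResonantLE m a b) (hba : ResonantLE m b a) : a = b := by
  obtain ⟨α, hα, ha⟩ := hab
  obtain ⟨β, hβ, hb⟩ := hba
  obtain ⟨α, rfl⟩ := exists_eq_add_single ha
  obtain ⟨β, rfl⟩ := exists_eq_add_single hb
  simp only [sum_cast_add_mul, sum_cast_single_mul] at hα hβ
  have hsum : α + β = 0 := hnonres _ fun k => by
    rw [sum_cast_add_mul]
    linarith [hα k, hβ k]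
  obtain ⟨rfl, -⟩ := add_eq_zero.mp hsum
  exact hm (funext fun k => by simpa using hα k)

end Resonance

/-- A partial order relation on `Fin n` admits a topological sorting. -/
theorem exists_perm_lt_of_rel {n : ℕ} (R : Fin n → Fin n → Prop) (hrefl : ∀ a, R a a)
    (htrans : ∀ {a b c}, R a b → R b c → R a c) (hanti : ∀ {a b}, R a b → R b a → a = b) :
    ∃ π : Equiv.Perm (Fin n), ∀ i j, i ≠ j → R (π i) (π j) → i < j := by
  classical
  let f : Fin n → ℕ := fun a => (Finset.univ.filter fun b => R b a).card
  refine ⟨Tuple.sort f, fun i j hij hR => (Tuple.monotone_sort f).reflect_lt ?_⟩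
  refine Finset.card_lt_card (Finset.ssubset_iff_of_subset (fun c hc => ?_) |>.mpr
    ⟨Tuple.sort f j, by simpa using hrefl _, fun hc => ?_⟩)
  · simp only [Finset.mem_filter_univ] at hc ⊢
    exact htrans hc hR
  · simp only [Finset.mem_filter_univ] at hc
    exact hij ((Tuple.sort f).injective (hanti hR hc))

/-- Under distinctness of the rows and the non-resonance condition,
the weights can be properly ordered: there is a permutation `π` of the indices
such that `m_{π(i)} < m_{π(j)}` only occurs for `i < j`. -/
theorem stmt_4 (n r : ℕ) (hn : 1 ≤ n) (hr : 1 ≤ r) (m : Fin n → Fin r → ℤ)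
    (hdist : ∀ i j : Fin n, i ≠ j → m i ≠ m j)
    (hnonres : ∀ γ : Fin n → ℕ, (∀ j : Fin r, ∑ l, (γ l : ℤ) * m l j = 0) → γ = 0) :
    ∃ π : Equiv.Perm (Fin n), ∀ i j : Fin n, i ≠ j →
      (∃ α : Fin n → ℕ, (∀ k : Fin r, ∑ l, (α l : ℤ) * m l k = m (π j) k) ∧ α (π i) ≠ 0) →
      i < j := by
  exact exists_perm_lt_of_rel (ResonantLE m) (ResonantLE.refl m) ResonantLE.trans
    (ResonantLE.antisymm (fun i j h => by_contra fun hij => hdist i j hij h) hnonres)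
end

section
/- Let n ≥ 1, r ≥ 1 and let m : Fin n → Fin r → ℤ be a weight matrix satisfying the non-resonance condition: the only γ ∈ ℕ^n with Σ_{l} γ_l m_{lj} = 0 for all 1 ≤ j ≤ r is γ = 0. Then for every 1 ≤ i ≤ n the i-th resonance set E_i = {α ∈ ℕ^n : α·m^j = m_{ij} for all j} is a finite set; in particular the i-th resonance order μ_i = max{|α| : α ∈ E_i} is well defined. -/
/-- Under the non-resonance condition, each resonance set `E_i` is
finite; in particular the `i`-th resonance order `μ_i = max{|α| : α ∈ E_i}`
is well defined. -/
theorem stmt_5 (n r : ℕ) (hn : 1 ≤ n) (hr : 1 ≤ r) (m : Fin n → Fin r → ℤ)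
    (hnonres : ∀ γ : Fin n → ℕ, (∀ j : Fin r, ∑ l, (γ l : ℤ) * m l j = 0) → γ = 0) :
    ∀ i : Fin n,
      Set.Finite {α : Fin n → ℕ | ∀ j : Fin r, ∑ l, (α l : ℤ) * m l j = m i j} := by
  intro i
  refine WellQuasiOrderedLE.finite_of_isAntichain fun α hα β hβ hne hle => hne ?_
  have hsub : β - α = 0 := by
    refine hnonres _ fun j => ?_
    have hcast : ∀ l, (((β - α) l : ℕ) : ℤ) = β l - α l := fun l => by
      rw [Pi.sub_apply, Nat.cast_sub (hle l)]
    simp only [hcast, sub_mul, Finset.sum_sub_distrib, hα j, hβ j, sub_self]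
  exact le_antisymm hle (tsub_eq_zero_iff_le.mp hsub)
end

section
/- Let n ≥ 1, r ≥ 1 and let m : Fin n → Fin r → ℤ be a weight matrix with pairwise distinct rows, satisfying the non-resonance condition (the only γ ∈ ℕ^n with γ·m^j = 0 for all j is γ = 0), and properly ordered (for i ≠ j, if there exists α ∈ E_j with α_i ≠ 0 then i < j). Let σ_1, …, σ_n ∈ MvPolynomial (Fin n) ℂ be of the form σ_i = X_i + g_i, where every multi-index α with nonzero coefficient in g_i satisfies α ∈ E_i and |α| ≥ 2. Then the polynomial map σ = (σ_1,…,σ_n) : ℂ^n → ℂ^n is a polynomial automorphism: there exist τ_1, …, τ_n ∈ MvPolynomial (Fin n) ℂ, with every multi-index with nonzero coefficient in τ_i lying in E_i, such that for all z ∈ ℂ^n, τ(σ(z)) = z and σ(τ(z)) = z, where τ = (τ_1,…,τ_n). -/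
open MvPolynomial

/-- Two substitutions that agree on the variables of `p` give the same evaluation of `p`. -/
theorem aeval_congr_of_vars {ι R S : Type*} [CommSemiring R] [CommSemiring S] [Algebra R S]
    {f f' : ι → S} {p : MvPolynomial ι R} (h : ∀ i ∈ p.vars, f i = f' i) :
    aeval f p = aeval f' p :=
  eval₂Hom_congr' rfl (fun i hi _ => h i hi) rfl

/-- Substituting into a weighted homogeneous polynomial, for each of its variables, a polynomial
homogeneous of the same weight as that variable preserves the weight. -/
theorem MvPolynomial.IsWeightedHomogeneous.bind₁ {ι κ R M : Type*} [CommSemiring R] [AddCommMonoid M]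
    {w : ι → M} {v : κ → M} {f : ι → MvPolynomial κ R} {p : MvPolynomial ι R} {d : M}
    (hp : IsWeightedHomogeneous w p d)
    (hf : ∀ i ∈ p.vars, IsWeightedHomogeneous v (f i) (w i)) :
    IsWeightedHomogeneous v (MvPolynomial.bind₁ f p) d := by
  rw [MvPolynomial.bind₁, aeval_def, eval₂_eq]
  refine IsWeightedHomogeneous.sum _ _ _ fun α hα => ?_
  rw [← hp (mem_support_iff.mp hα), algebraMap_eq, Finsupp.weight_apply]
  exact (IsWeightedHomogeneous.prod _ _ _ fun i hi =>
    (hf i ((mem_vars_iff_mem_support i).mpr ⟨α, hα, hi⟩)).pow _).C_mul _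

/-- The recursion `τ i = X i - g i (τ)` is solvable when `g i` only involves variables below `i`. -/
theorem exists_triangular_recursion {ι R : Type*} [CommRing R] [LT ι] [WellFoundedLT ι]
    (g : ι → MvPolynomial ι R) (hg : ∀ i, ∀ l ∈ (g i).vars, l < i) :
    ∃ τ : ι → MvPolynomial ι R, ∀ i, τ i = X i - bind₁ τ (g i) := by
  classical
  let F (i : ι) (ih : ∀ l, l < i → MvPolynomial ι R) : MvPolynomial ι R :=
    X i - bind₁ (fun l => if h : l < i then ih l h else 0) (g i)
  refine ⟨wellFounded_lt.fix F, fun i => ?_⟩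
  rw [WellFounded.fix_eq]
  exact congrArg (X i - ·) (aeval_congr_of_vars fun l hl => dif_pos (hg i l hl))

/-- If only the zero exponent has weight zero, then an exponent with the same weight as the
variable `i` and degree different from one does not involve `i`. -/
theorem apply_eq_zero_of_weight_eq {ι M : Type*} [AddCommGroup M] {w : ι → M}
    (hw : ∀ γ : ι →₀ ℕ, Finsupp.weight w γ = 0 → γ = 0) {α : ι →₀ ℕ} {i : ι}
    (hα : Finsupp.weight w α = w i) (hdeg : α.degree ≠ 1) : α i = 0 := by
  by_contra hi
  have hle : Finsupp.single i 1 ≤ α := by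
    simpa [Finsupp.single_le_iff] using Nat.one_le_iff_ne_zero.mpr hi
  obtain ⟨γ, rfl⟩ := exists_add_of_le hle
  have hγ : γ = 0 := hw γ (by simpa [Finsupp.weight_single] using hα)
  simp [hγ] at hdeg

/-- With distinct, non-resonant and properly ordered weights, any
tuple `σ_i = X_i + g_i` whose `g_i` consists only of nonlinear `i`-th resonant
monomials defines a polynomial automorphism of `ℂ^n`, whose inverse is also
given by polynomials with only `i`-th resonant monomials. -/
theorem stmt_8 (n r : ℕ) (hn : 1 ≤ n) (hr : 1 ≤ r) (m : Fin n → Fin r → ℤ)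
    (hdist : ∀ i j : Fin n, i ≠ j → m i ≠ m j)
    (hnonres : ∀ γ : Fin n → ℕ, (∀ j : Fin r, ∑ l, (γ l : ℤ) * m l j = 0) → γ = 0)
    (hord : ∀ i j : Fin n, i ≠ j →
      (∃ α : Fin n → ℕ, (∀ k : Fin r, ∑ l, (α l : ℤ) * m l k = m j k) ∧ α i ≠ 0) → i < j)
    (g : Fin n → MvPolynomial (Fin n) ℂ)
    (hg : ∀ i : Fin n, ∀ α ∈ (g i).support,
      (∀ k : Fin r, ∑ l, ((α l : ℤ)) * m l k = m i k) ∧ 2 ≤ ∑ l, α l)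
    (σ : Fin n → MvPolynomial (Fin n) ℂ) (hσ : ∀ i, σ i = X i + g i) :
    ∃ τ : Fin n → MvPolynomial (Fin n) ℂ,
      (∀ i : Fin n, ∀ α ∈ (τ i).support,
        ∀ k : Fin r, ∑ l, ((α l : ℤ)) * m l k = m i k) ∧
      (∀ z : Fin n → ℂ, ∀ i : Fin n,
        eval (fun l => eval z (σ l)) (τ i) = z i) ∧
      (∀ z : Fin n → ℂ, ∀ i : Fin n,
        eval (fun l => eval z (τ l)) (σ i) = z i) := by
  have weight_eq_iff (α : Fin n →₀ ℕ) (v : Fin r → ℤ) :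
      Finsupp.weight m α = v ↔ ∀ k, ∑ l, (α l : ℤ) * m l k = v k := by
    rw [Finsupp.weight_apply, Finsupp.sum_fintype _ _ (by simp), funext_iff]
    simp
  have hw (γ : Fin n →₀ ℕ) (hγ : Finsupp.weight m γ = 0) : γ = 0 :=
    DFunLike.coe_injective (hnonres γ ((weight_eq_iff γ 0).mp hγ))
  have hvars (i : Fin n) : ∀ l ∈ (g i).vars, l < i := by
    intro l hl
    obtain ⟨α, hα, hlα⟩ := (mem_vars_iff_mem_support l).mp hl
    obtain ⟨hres, hdeg⟩ := hg i α hα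
    have hαl : α l ≠ 0 := Finsupp.mem_support_iff.mp hlα
    refine hord l i ?_ ⟨α, hres, hαl⟩
    rintro rfl
    refine hαl (apply_eq_zero_of_weight_eq hw ((weight_eq_iff α _).mpr hres) ?_)
    rw [Finsupp.degree_eq_sum]
    omega
  obtain ⟨τ, hτ⟩ := exists_triangular_recursion g hvars
  have eval_τ (z : Fin n → ℂ) (i : Fin n) :
      eval z (τ i) = z i - eval (fun l => eval z (τ l)) (g i) := by
    conv_lhs => rw [hτ i]
    rw [map_sub, eval_X, ← coe_aeval_eq_eval, RingHom.coe_coe, aeval_bind₁]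
    rfl
  refine ⟨τ, fun i α hα => ?_, fun z i => ?_, fun z i => ?_⟩
  · have hom : IsWeightedHomogeneous m (τ i) (m i) := by
      clear α hα
      induction i using WellFoundedLT.induction with
      | ind i ih =>
        rw [hτ i]
        refine (isWeightedHomogeneous_X ℂ m i).sub (IsWeightedHomogeneous.bind₁ (w := m) ?_ ?_)
        · exact fun α hα => (weight_eq_iff α _).mpr (hg i α (mem_support_iff.mpr hα)).1
        · exact fun l hl => ih l (hvars i l hl)
    exact (weight_eq_iff α _).mp (hom (mem_support_iff.mp hα))
  · induction i using WellFoundedLT.induction with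
    | ind i ih =>
      have hcongr : eval (fun l => eval (fun k => eval z (σ k)) (τ l)) (g i) = eval z (g i) :=
        aeval_congr_of_vars fun l hl => ih l (hvars i l hl)
      rw [eval_τ, hcongr, hσ i, map_add, eval_X, add_sub_cancel_right]
  · rw [hσ i, map_add, eval_X, eval_τ, sub_add_cancel]
end

section
/- Let n ≥ 1, r ≥ 1 and let m : Fin n → Fin r → ℤ be a weight matrix with pairwise distinct rows, satisfying the non-resonance condition (the only γ ∈ ℕ^n with γ·m^j = 0 for all j is γ = 0), properly ordered (for i ≠ j, if there exists α ∈ E_j with α_i ≠ 0 then i < j). Let μ ∈ ℕ be such that |α| ≤ μ for every α ∈ E_i and every 1 ≤ i ≤ n (μ is an upper bound for the resonance order). Let σ_1, …, σ_n ∈ MvPolynomial (Fin n) ℂ be of the form σ_i = X_i + g_i, where every multi-index with nonzero coefficient in g_i lies in E_i and has |α| ≥ 2. Then each σ_i has total degree at most μ, and there exist τ_1, …, τ_n ∈ MvPolynomial (Fin n) ℂ with total degree of each τ_i at most μ, such that for all z ∈ ℂ^n, τ(σ(z)) = z and σ(τ(z)) = z. -/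
open MvPolynomial

namespace TriangularInverse

theorem isWeightedHomogeneous_bind₁ {ι κ R M : Type*} [CommSemiring R] [AddCommMonoid M]
    {v : ι → M} {w : κ → M} {f : ι → MvPolynomial κ R} {p : MvPolynomial ι R} {d : M}
    (hf : ∀ i, IsWeightedHomogeneous w (f i) (v i)) (hp : IsWeightedHomogeneous v p d) :
    IsWeightedHomogeneous w (bind₁ f p) d := by
  classical
  rw [p.as_sum, map_sum]
  refine Submodule.sum_mem (weightedHomogeneousSubmodule R w d) fun α hα => ?_
  rw [mem_weightedHomogeneousSubmodule, bind₁_monomial, ← zero_add d,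
    ← hp (mem_support_iff.mp hα), Finsupp.weight_apply]
  exact (isWeightedHomogeneous_C w _).mul
    (IsWeightedHomogeneous.prod _ _ _ fun l _ => (hf l).pow (α l))

theorem bind₁_congr_vars {ι κ R : Type*} [CommSemiring R] {f f' : ι → MvPolynomial κ R}
    {p : MvPolynomial ι R} (h : ∀ i ∈ p.vars, f i = f' i) : bind₁ f p = bind₁ f' p :=
  eval₂Hom_congr' rfl (fun i hi _ => h i hi) rfl

variable {n : ℕ} {R : Type*} [CommRing R]

/-- The fixed-point iterates of `T ↦ X - g ∘ T`, starting from the identity. -/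
noncomputable def iterate (g : Fin n → MvPolynomial (Fin n) R) :
    ℕ → Fin n → MvPolynomial (Fin n) R
  | 0 => X
  | k + 1 => fun i => X i - bind₁ (iterate g k) (g i)

theorem iterate_succ_eq {g : Fin n → MvPolynomial (Fin n) R}
    (hg : ∀ i, ∀ l ∈ (g i).vars, l < i) (k : ℕ) (i : Fin n) (hi : (i : ℕ) < k) :
    iterate g (k + 1) i = iterate g k i := by
  induction k generalizing i with
  | zero => omega
  | succ k ih =>
    change X i - bind₁ (iterate g (k + 1)) (g i) = X i - bind₁ (iterate g k) (g i)
    rw [bind₁_congr_vars fun l hl => ih l ?_]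
    have : (l : ℕ) < i := hg i l hl
    omega

theorem isWeightedHomogeneous_iterate {M : Type*} [AddCommMonoid M] {w : Fin n → M}
    {g : Fin n → MvPolynomial (Fin n) R} (hg : ∀ i, IsWeightedHomogeneous w (g i) (w i))
    (k : ℕ) (i : Fin n) : IsWeightedHomogeneous w (iterate g k i) (w i) := by
  induction k generalizing i with
  | zero => exact isWeightedHomogeneous_X R w i
  | succ k ih =>
    exact Submodule.sub_mem (weightedHomogeneousSubmodule R w (w i))
      (isWeightedHomogeneous_X R w i) (isWeightedHomogeneous_bind₁ ih (hg i))

/-- A triangular perturbation of the identity by weighted homogeneous terms has a polynomial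
inverse which respects the weights. -/
theorem exists_inverse {M : Type*} [AddCommMonoid M] {w : Fin n → M}
    {g : Fin n → MvPolynomial (Fin n) R} (hvars : ∀ i, ∀ l ∈ (g i).vars, l < i)
    (hg : ∀ i, IsWeightedHomogeneous w (g i) (w i)) :
    ∃ τ : Fin n → MvPolynomial (Fin n) R, (∀ i, IsWeightedHomogeneous w (τ i) (w i)) ∧
      (∀ i, bind₁ (fun l => X l + g l) (τ i) = X i) ∧ ∀ i, bind₁ τ (X i + g i) = X i := by
  have hτ (i : Fin n) : iterate g n i = X i - bind₁ (iterate g n) (g i) :=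
    (iterate_succ_eq hvars n i i.isLt).symm
  refine ⟨iterate g n, isWeightedHomogeneous_iterate hg n, fun i => ?_, fun i => ?_⟩
  · induction i using WellFoundedLT.induction with
    | ind i ih =>
      rw [hτ, map_sub, bind₁_X_right, bind₁_bind₁,
        bind₁_congr_vars fun l hl => ih l (hvars i l hl)]
      simp [bind₁_X_left]
  · rw [map_add, bind₁_X_right]
    nth_rewrite 1 [hτ]
    ring

theorem weight_eq_iff {r : ℕ} (m : Fin n → Fin r → ℤ) (α : Fin n →₀ ℕ) (d : Fin r → ℤ) :
    Finsupp.weight m α = d ↔ ∀ k, ∑ l, (α l : ℤ) * m l k = d k := by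
  rw [Finsupp.weight_apply, Finsupp.sum_fintype _ _ (by simp), funext_iff]
  simp

theorem totalDegree_le_of_isWeightedHomogeneous {r : ℕ} {m : Fin n → Fin r → ℤ} {d : Fin r → ℤ}
    {μ : ℕ} (hμ : ∀ α : Fin n → ℕ, (∀ k, ∑ l, (α l : ℤ) * m l k = d k) → ∑ l, α l ≤ μ)
    {p : MvPolynomial (Fin n) R} (hp : IsWeightedHomogeneous m p d) : p.totalDegree ≤ μ := by
  refine Finset.sup_le fun α hα => ?_
  rw [Finsupp.sum_fintype _ _ (by simp)]
  exact hμ α ((weight_eq_iff m α d).mp (hp (mem_support_iff.mp hα)))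

theorem coord_eq_zero_of_resonant {r : ℕ} {m : Fin n → Fin r → ℤ}
    (hnonres : ∀ γ : Fin n → ℕ, (∀ j : Fin r, ∑ l, (γ l : ℤ) * m l j = 0) → γ = 0)
    {i : Fin n} {α : Fin n → ℕ} (hα : ∀ k, ∑ l, (α l : ℤ) * m l k = m i k)
    (hdeg : 2 ≤ ∑ l, α l) : α i = 0 := by
  by_contra hi
  have hsplit : α = (α - Pi.single i 1) + Pi.single i 1 :=
    (tsub_add_cancel_of_le fun l => by
      rcases eq_or_ne l i with rfl | hl
      · simpa using Nat.one_le_iff_ne_zero.mpr hi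
      · simp [hl]).symm
  have h0 := hnonres (α - Pi.single i 1) fun k => by
    have h := hα k
    rw [hsplit] at h
    simpa [add_mul, Finset.sum_add_distrib, Pi.single_apply] using h
  rw [hsplit, h0] at hdeg
  simp at hdeg

end TriangularInverse

open TriangularInverse

/-- With distinct, non-resonant, properly ordered weights and `μ`
an upper bound for the resonance order, any tuple `σ_i = X_i + g_i` with `g_i`
consisting only of nonlinear `i`-th resonant monomials has degree at most `μ`,
and its inverse is polynomial of degree at most `μ`. -/
theorem stmt_9 (n r : ℕ) (hn : 1 ≤ n) (hr : 1 ≤ r) (m : Fin n → Fin r → ℤ)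
    (hdist : ∀ i j : Fin n, i ≠ j → m i ≠ m j)
    (hnonres : ∀ γ : Fin n → ℕ, (∀ j : Fin r, ∑ l, (γ l : ℤ) * m l j = 0) → γ = 0)
    (hord : ∀ i j : Fin n, i ≠ j →
      (∃ α : Fin n → ℕ, (∀ k : Fin r, ∑ l, (α l : ℤ) * m l k = m j k) ∧ α i ≠ 0) → i < j)
    (μ : ℕ)
    (hμ : ∀ i : Fin n, ∀ α : Fin n → ℕ,
      (∀ k : Fin r, ∑ l, (α l : ℤ) * m l k = m i k) → ∑ l, α l ≤ μ)
    (g : Fin n → MvPolynomial (Fin n) ℂ)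
    (hg : ∀ i : Fin n, ∀ α ∈ (g i).support,
      (∀ k : Fin r, ∑ l, ((α l : ℤ)) * m l k = m i k) ∧ 2 ≤ ∑ l, α l)
    (σ : Fin n → MvPolynomial (Fin n) ℂ) (hσ : ∀ i, σ i = X i + g i) :
    (∀ i : Fin n, (σ i).totalDegree ≤ μ) ∧
    ∃ τ : Fin n → MvPolynomial (Fin n) ℂ,
      (∀ i : Fin n, (τ i).totalDegree ≤ μ) ∧
      (∀ z : Fin n → ℂ, ∀ i : Fin n,
        eval (fun l => eval z (σ l)) (τ i) = z i) ∧
      (∀ z : Fin n → ℂ, ∀ i : Fin n,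
        eval (fun l => eval z (τ l)) (σ i) = z i) := by
  have hw (i : Fin n) : IsWeightedHomogeneous m (g i) (m i) := fun α hα =>
    (weight_eq_iff m α (m i)).mpr (hg i α (mem_support_iff.mpr hα)).1
  have hvars (i l : Fin n) (hl : l ∈ (g i).vars) : l < i := by
    obtain ⟨α, hα, hlα⟩ := (mem_vars_iff_mem_support l).mp hl
    obtain ⟨hres, hdeg⟩ := hg i α hα
    have hne : α l ≠ 0 := Finsupp.mem_support_iff.mp hlα
    refine hord l i ?_ ⟨α, hres, hne⟩
    rintro rfl
    exact hne (coord_eq_zero_of_resonant hnonres hres hdeg)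
  obtain rfl : σ = fun i => X i + g i := funext hσ
  obtain ⟨τ, hτ, hτσ, hστ⟩ := exists_inverse hvars hw
  have eval_comp (f : Fin n → MvPolynomial (Fin n) ℂ) (p : MvPolynomial (Fin n) ℂ)
      (z : Fin n → ℂ) : eval (fun l => eval z (f l)) p = eval z (bind₁ f p) :=
    (eval₂Hom_bind₁ (RingHom.id ℂ) z f p).symm
  refine ⟨fun i => totalDegree_le_of_isWeightedHomogeneous (hμ i)
      ((isWeightedHomogeneous_X ℂ m i).add (hw i)), τ,
    fun i => totalDegree_le_of_isWeightedHomogeneous (hμ i) (hτ i), fun z i => ?_, fun z i => ?_⟩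
  · rw [eval_comp, hτσ, eval_X]
  · rw [eval_comp, hστ, eval_X]
end
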